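/- Let F = M_1 + M_2 = x_0x_1^{a_1}⋯x_n^{a_n} + y_0^{b_0}y_1^{b_1}⋯y_m^{b_m} ∈ ℂ[x_0,…,x_n,y_0,…,y_m], where all exponents are at least 1, b_0 ≤ b_i for all i = 1,…,m, and the common degree d = 1 + a_1 + ⋯ + a_n = b_0 + ⋯ + b_m satisfies d ≥ 3. Then the Waring locus of F is the union of the Waring loci of M_1 and M_2: a nonzero linear form L lies in W_F if and only if either L involves only x_0,…,x_n and L ∈ W_{M_1}, or L involves only y_0,…,y_m and L ∈ W_{M_2}. Equivalently, every minimal Waring decomposition of F is the sum of a minimal Waring decomposition of M_1 and a minimal Waring decomposition of M_2. -/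

import Mathlib

open MvPolynomial

noncomputable section

/-- The linear form `c₀x₀ + ⋯ + cₙxₙ` with coefficient vector `c`. -/
def lin {σ : Type*} [Fintype σ] (c : σ → ℂ) : MvPolynomial σ ℂ :=
  ∑ i, C (c i) * X i

/-- `F` admits a Waring decomposition `F = L₁^d + ⋯ + L_r^d`. -/
def HasWaringDecomp {σ : Type*} [Fintype σ] (d : ℕ) (F : MvPolynomial σ ℂ) (r : ℕ) : Prop :=
  ∃ L : Fin r → σ → ℂ, F = ∑ j, lin (L j) ^ d

/-- The Waring rank of `F` (as a form of degree `d`). -/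
def waringRank {σ : Type*} [Fintype σ] (d : ℕ) (F : MvPolynomial σ ℂ) : ℕ :=
  sInf {r | HasWaringDecomp d F r}

/-- The linear form with coefficient vector `a` lies in the Waring locus of `F`:
there are linear forms `L₂, …, L_r` with `r = rk F` such that `F` lies in the
`ℂ`-linear span of `L^d, L₂^d, …, L_r^d`. -/
def InWaringLocus {σ : Type*} [Fintype σ] (d : ℕ) (F : MvPolynomial σ ℂ) (a : σ → ℂ) : Prop :=
  ∃ (c : Fin (waringRank d F) → ℂ) (L : Fin (waringRank d F) → σ → ℂ)
    (j₀ : Fin (waringRank d F)), L j₀ = a ∧ F = ∑ j, c j • lin (L j) ^ d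

/-- Coefficients of a power of a linear form. -/
theorem coeff_lin_pow {σ : Type*} [Fintype σ] [DecidableEq σ] (p : σ → ℂ) (d : ℕ) (γ : σ →₀ ℕ)
    (hγ : γ.degree = d) :
    coeff γ (lin p ^ d) = (Nat.multinomial Finset.univ γ : ℂ) * ∏ i, p i ^ γ i := by
  have key : ∀ k : σ → ℕ, ((Nat.multinomial Finset.univ k : MvPolynomial σ ℂ) *
      ∏ i, (C (p i) * X i) ^ k i) = monomial (Finsupp.equivFunOnFinite.symm k)
        ((Nat.multinomial Finset.univ k : ℂ) * ∏ i, p i ^ k i) := by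
    intro k
    rw [monomial_eq, Finsupp.prod_fintype _ _ (by simp)]
    simp only [mul_pow, Finset.prod_mul_distrib, map_mul, map_prod, map_pow, map_natCast,
      Finsupp.equivFunOnFinite_symm_apply_apply]
    ring
  unfold lin
  rw [Finset.sum_pow_eq_sum_piAntidiag, coeff_sum]
  simp only [key, coeff_monomial]
  rw [Finset.sum_eq_single (γ : σ → ℕ)]
  · simp
  · intro k _ hk
    rw [if_neg]
    intro h
    apply hk
    rw [← h]; rfl
  · intro h
    exfalso
    apply h
    rw [Finset.mem_piAntidiag]
    refine ⟨?_, by simp⟩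
    rw [← hγ, Finsupp.degree_eq_sum]

theorem lin_isHomogeneous {σ : Type*} [Fintype σ] (p : σ → ℂ) : (lin p).IsHomogeneous 1 := by
  unfold lin
  apply IsHomogeneous.sum
  intro i _
  exact isHomogeneous_C_mul_X _ _

theorem lin_smul {σ : Type*} [Fintype σ] (z : ℂ) (p : σ → ℂ) : lin (z • p) = C z * lin p := by
  unfold lin
  simp [Finset.mul_sum, mul_assoc]

theorem hasWaringDecomp_of_fintype {σ ι : Type*} [Fintype σ] [Fintype ι] {d : ℕ} (hd : 0 < d)
    {F : MvPolynomial σ ℂ} (c : ι → ℂ) (p : ι → σ → ℂ) (h : F = ∑ j, c j • lin (p j) ^ d) :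
    HasWaringDecomp d F (Fintype.card ι) := by
  choose z hz using fun j => IsAlgClosed.exists_pow_nat_eq (c j) hd
  refine ⟨fun j => z ((Fintype.equivFin ι).symm j) • p ((Fintype.equivFin ι).symm j), ?_⟩
  rw [h, ← Equiv.sum_comp (Fintype.equivFin ι).symm]
  refine Finset.sum_congr rfl fun j _ => ?_
  rw [lin_smul, mul_pow, ← map_pow, hz, smul_eq_C_mul]

theorem inWaringLocus_of_fintype {σ ι : Type*} [Fintype σ] [Fintype ι] {d : ℕ}
    {F : MvPolynomial σ ℂ} (c : ι → ℂ) (p : ι → σ → ℂ) (h : F = ∑ j, c j • lin (p j) ^ d)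
    (hc : Fintype.card ι = waringRank d F) (j : ι) : InWaringLocus d F (p j) := by
  let e : Fin (waringRank d F) ≃ ι := (finCongr hc.symm).trans (Fintype.equivFin ι).symm
  refine ⟨fun i => c (e i), fun i => p (e i), e.symm j, by simp, ?_⟩
  exact h.trans (Equiv.sum_comp e (fun j => c j • lin (p j) ^ d)).symm

theorem waringRank_le {σ : Type*} [Fintype σ] {d r : ℕ} {F : MvPolynomial σ ℂ}
    (h : HasWaringDecomp d F r) : waringRank d F ≤ r := Nat.sInf_le h

theorem hasWaringDecomp_rank {σ : Type*} [Fintype σ] {d r : ℕ} {F : MvPolynomial σ ℂ}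
    (h : HasWaringDecomp d F r) : HasWaringDecomp d F (waringRank d F) :=
  Nat.sInf_mem (s := {r | HasWaringDecomp d F r}) ⟨r, h⟩

/-- The moments of a decomposition of `x^A + x^B`. -/
theorem moments {σ ι : Type*} [Fintype σ] [DecidableEq σ] [Fintype ι] (d : ℕ)
    (A B : σ →₀ ℕ)
    (c : ι → ℂ) (p : ι → σ → ℂ)
    (h : monomial A (1 : ℂ) + monomial B 1 = ∑ j, c j • lin (p j) ^ d)
    (hAB : A ≠ B) :
    ∃ κ₁ κ₂ : ℂ, κ₁ ≠ 0 ∧ κ₂ ≠ 0 ∧ ∀ g : MvPolynomial σ ℂ, g.IsHomogeneous d →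
      ∑ j, c j * eval (p j) g = κ₁ * coeff A g + κ₂ * coeff B g := by
  have hne : ∀ γ : σ →₀ ℕ, (Nat.multinomial Finset.univ γ : ℂ) ≠ 0 := fun γ => by
    exact_mod_cast (Nat.multinomial_pos _ _).ne'
  have hmom : ∀ γ : σ →₀ ℕ, γ.degree = d → ∑ j, c j * ∏ i, p j i ^ γ i =
      (Nat.multinomial Finset.univ γ : ℂ)⁻¹ *
        ((if A = γ then 1 else 0) + (if B = γ then 1 else 0)) := by
    intro γ hγ
    have := congrArg (coeff γ) h
    rw [coeff_sum, coeff_add, coeff_monomial, coeff_monomial] at this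
    simp only [coeff_smul, coeff_lin_pow _ d γ hγ, smul_eq_mul] at this
    rw [this, Finset.mul_sum]
    refine Finset.sum_congr rfl fun j _ => ?_
    field_simp [hne γ]
  refine ⟨(Nat.multinomial Finset.univ A : ℂ)⁻¹, (Nat.multinomial Finset.univ B : ℂ)⁻¹,
    inv_ne_zero (hne _), inv_ne_zero (hne _), fun g hg => ?_⟩
  simp only [eval_eq', Finset.mul_sum]
  rw [Finset.sum_comm]
  have : ∀ γ ∈ g.support, ∑ j, c j * (coeff γ g * ∏ i, p j i ^ γ i) =
      (if A = γ then (Nat.multinomial Finset.univ A : ℂ)⁻¹ * coeff A g else 0) +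
      (if B = γ then (Nat.multinomial Finset.univ B : ℂ)⁻¹ * coeff B g else 0) := by
    intro γ hγ
    have hdeg : γ.degree = d := by
      by_contra hne
      exact (mem_support_iff.1 hγ) (hg.coeff_eq_zero hne)
    have e1 : ∑ j, c j * (coeff γ g * ∏ i, p j i ^ γ i) =
        coeff γ g * ∑ j, c j * ∏ i, p j i ^ γ i := by
      rw [Finset.mul_sum]
      exact Finset.sum_congr rfl fun j _ => by ring
    rw [e1, hmom γ hdeg]
    split_ifs with h1 h2 h2
    · exact absurd (h1.trans h2.symm) hAB
    · subst h1; ring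
    · subst h2; ring
    · ring
  rw [Finset.sum_congr rfl this, Finset.sum_add_distrib, Finset.sum_ite_eq, Finset.sum_ite_eq]
  congr 1
  · split_ifs with h1
    · rfl
    · rw [notMem_support_iff.1 h1]; simp
  · split_ifs with h1
    · rfl
    · rw [notMem_support_iff.1 h1]; simp

theorem card_Iic_eq {σ : Type*} [Fintype σ] [DecidableEq σ] (f : σ →₀ ℕ) :
    (Finset.Iic f).card = ∏ i, (f i + 1) := by
  rw [Finsupp.card_Iic]
  simp only [Nat.card_Iic]
  refine Finset.prod_subset (Finset.subset_univ _) fun i _ hi => ?_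
  simp [Finsupp.notMem_support_iff.1 hi]

theorem degree_lt_card_Iic {σ : Type*} [Fintype σ] [DecidableEq σ] (f : σ →₀ ℕ) :
    f.degree + 1 ≤ (Finset.Iic f).card := by
  rw [card_Iic_eq, Finsupp.degree_eq_sum]
  have : ∀ s : Finset σ, ∑ i ∈ s, f i + 1 ≤ ∏ i ∈ s, (f i + 1) := by
    intro s
    induction s using Finset.induction_on with
    | empty => simp
    | insert a s ha ih =>
      rw [Finset.sum_insert ha, Finset.prod_insert ha]
      nlinarith [Nat.zero_le (f a), Nat.zero_le (∑ i ∈ s, f i)]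
  exact this _

/-- Upper bound for the rank of a monomial. -/
theorem monomial_decomp {σ : Type*} [Fintype σ] [DecidableEq σ] (d : ℕ) (A : σ →₀ ℕ) (x0 : σ)
    (hd : 0 < d) (hA : A.degree = d) (hx0 : 1 ≤ A x0) (hmin : ∀ i, 1 ≤ A i → A x0 ≤ A i) :
    HasWaringDecomp d (monomial A (1 : ℂ)) (Finset.Iic (A.erase x0)).card := by
  set B := A.erase x0 with hB
  have hB0 : B x0 = 0 := Finsupp.erase_same
  have hB1 : ∀ i, i ≠ x0 → B i = A i := fun i hi => Finsupp.erase_ne hi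
  let ζ : σ → ℂ := fun i => Complex.exp (2 * Real.pi * Complex.I / ((B i + 1 : ℕ) : ℂ))
  have hζ : ∀ i, IsPrimitiveRoot (ζ i) (B i + 1) := fun i =>
    Complex.isPrimitiveRoot_exp _ (Nat.succ_ne_zero _)
  let P : (∀ i, Fin (B i + 1)) → σ → ℂ := fun k i => if A i = 0 then 0 else ζ i ^ (k i : ℕ)
  let w : (∀ i, Fin (B i + 1)) → ℂ := fun k => ∏ i, ζ i ^ (k i : ℕ)
  -- factorised moments
  have hmom : ∀ γ : σ →₀ ℕ, ∑ k, w k * ∏ i, P k i ^ γ i =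
      ∏ i, ∑ k : Fin (B i + 1), ζ i ^ (k : ℕ) * (if A i = 0 then 0 else ζ i ^ (k : ℕ)) ^ γ i := by
    intro γ
    rw [Finset.prod_univ_sum, Fintype.piFinset_univ]
    refine Finset.sum_congr rfl fun k _ => ?_
    rw [← Finset.prod_mul_distrib]
  have hfac0 : ∀ i g, A i = 0 → g ≠ 0 →
      ∑ k : Fin (B i + 1), ζ i ^ (k : ℕ) * (if A i = 0 then 0 else ζ i ^ (k : ℕ)) ^ g = 0 := by
    intro i g h0 hg
    simp [h0, hg]
  have hfac1 : ∀ i g, A i ≠ 0 → ¬ (B i + 1 ∣ g + 1) →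
      ∑ k : Fin (B i + 1), ζ i ^ (k : ℕ) * (if A i = 0 then 0 else ζ i ^ (k : ℕ)) ^ g = 0 := by
    intro i g h0 hg
    simp only [h0, if_false]
    have h1 : ζ i ^ (g + 1) ≠ 1 := fun h => hg ((hζ i).dvd_of_pow_eq_one _ h)
    have h2 : ∑ k : Fin (B i + 1), ζ i ^ (k : ℕ) * (ζ i ^ (k : ℕ)) ^ g =
        ∑ k ∈ Finset.range (B i + 1), (ζ i ^ (g + 1)) ^ k := by
      rw [← Fin.sum_univ_eq_sum_range (fun k => (ζ i ^ (g + 1)) ^ k)]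
      exact Finset.sum_congr rfl fun k _ => by ring
    rw [h2, geom_sum_eq h1, ← pow_mul, mul_comm, pow_mul, (hζ i).pow_eq_one]
    simp
  have hfac2 : ∀ i, ∑ k : Fin (B i + 1), ζ i ^ (k : ℕ) *
      (if A i = 0 then 0 else ζ i ^ (k : ℕ)) ^ A i ≠ 0 := by
    intro i
    have h3 : ∀ k : Fin (B i + 1), ζ i ^ (k : ℕ) *
      (if A i = 0 then 0 else ζ i ^ (k : ℕ)) ^ A i = 1 := by
      intro k
      by_cases hi : i = x0
      · have hz : B i = 0 := by rw [hi, hB0]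
        have hk : (k : ℕ) = 0 := by have := k.2; omega
        rw [if_neg (by rw [hi]; omega), hk]; simp
      · by_cases h0 : A i = 0
        · have hz : B i = 0 := by rw [hB1 i hi, h0]
          have hk : (k : ℕ) = 0 := by have := k.2; omega
          simp [h0, hk]
        · rw [if_neg h0, ← hB1 i hi]
          calc ζ i ^ (k : ℕ) * (ζ i ^ (k : ℕ)) ^ B i = (ζ i ^ (B i + 1)) ^ (k : ℕ) := by ring
            _ = 1 := by rw [(hζ i).pow_eq_one, one_pow]
    rw [Finset.sum_congr rfl fun k _ => h3 k]
    simp only [Finset.sum_const, Finset.card_univ, Fintype.card_fin, nsmul_eq_mul, mul_one]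
    exact_mod_cast Nat.succ_ne_zero (B i)
  have hvan : ∀ γ : σ →₀ ℕ, γ.degree = d → γ ≠ A → ∑ k, w k * ∏ i, P k i ^ γ i = 0 := by
    intro γ hγ hne
    rw [hmom]
    by_contra hprod
    rw [Finset.prod_eq_zero_iff] at hprod
    push Not at hprod
    have hz : ∀ i, A i = 0 → γ i = 0 := by
      intro i h0
      by_contra hg
      exact hprod i (Finset.mem_univ _) (hfac0 i _ h0 hg)
    have hdvd : ∀ i, A i ≠ 0 → B i + 1 ∣ γ i + 1 := by
      intro i h0
      by_contra hg
      exact hprod i (Finset.mem_univ _) (hfac1 i _ h0 hg)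
    have hge : ∀ i, B i ≤ γ i := by
      intro i
      by_cases h0 : A i = 0
      · by_cases hi : i = x0
        · rw [hi, hB0]; omega
        · rw [hB1 i hi, h0]; omega
      · have := Nat.le_of_dvd (Nat.succ_pos _) (hdvd i h0)
        omega
    have hsA : ∑ i, A i = d := by rw [← hA, Finsupp.degree_eq_sum]
    have hsγ : ∑ i, γ i = d := by rw [← hγ, Finsupp.degree_eq_sum]
    have hsB : ∑ i, B i + A x0 = d := by
      rw [← hsA, ← Finset.add_sum_erase _ _ (Finset.mem_univ x0),
        ← Finset.add_sum_erase Finset.univ A (Finset.mem_univ x0), hB0]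
      have : ∑ i ∈ Finset.univ.erase x0, B i = ∑ i ∈ Finset.univ.erase x0, A i :=
        Finset.sum_congr rfl fun i hi => hB1 i (Finset.ne_of_mem_erase hi)
      omega
    have heq : ∀ i, i ≠ x0 → γ i = A i := by
      intro i hi
      by_cases h0 : A i = 0
      · rw [h0, hz i h0]
      · by_contra hgi
        have h1 := hge i
        have h2 := hB1 i hi
        obtain ⟨q, hq⟩ := hdvd i h0
        have hq2 : 2 ≤ q := by
          by_contra hq1
          have : q = 0 ∨ q = 1 := by omega
          rcases this with h | h
          · rw [h] at hq; omega
          · rw [h] at hq; omega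
        have h3 : 2 * (B i + 1) ≤ γ i + 1 := by rw [hq]; nlinarith
        have h4 := hmin i (by omega)
        have h5 : ∑ j, B j + (γ i - B i) ≤ ∑ j, γ j := by
          rw [← Finset.add_sum_erase _ _ (Finset.mem_univ i),
            ← Finset.add_sum_erase Finset.univ γ (Finset.mem_univ i)]
          have := Finset.sum_le_sum (s := Finset.univ.erase i) fun j _ => hge j
          omega
        omega
    apply hne
    ext i
    by_cases hi : i = x0
    · rw [hi]
      rw [← Finset.add_sum_erase _ _ (Finset.mem_univ x0)] at hsA hsγ
      have : ∑ i ∈ Finset.univ.erase x0, γ i = ∑ i ∈ Finset.univ.erase x0, A i :=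
        Finset.sum_congr rfl fun i hi => heq i (Finset.ne_of_mem_erase hi)
      omega
    · exact heq i hi
  have hK : ∑ k, w k * ∏ i, P k i ^ A i ≠ 0 := by
    rw [hmom]
    exact Finset.prod_ne_zero_iff.2 fun i _ => hfac2 i
  obtain ⟨K, hKdef⟩ : ∃ K, K = ∑ k, w k * ∏ i, P k i ^ A i := ⟨_, rfl⟩
  rw [← hKdef] at hK
  have hN : (Nat.multinomial Finset.univ A : ℂ) ≠ 0 := by
    exact_mod_cast (Nat.multinomial_pos _ _).ne'
  have hcard : (Finset.Iic B).card = Fintype.card (∀ i, Fin (B i + 1)) := by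
    rw [card_Iic_eq, Fintype.card_pi]; simp
  rw [hcard]
  refine hasWaringDecomp_of_fintype hd
    (fun k => ((Nat.multinomial Finset.univ A : ℂ) * K)⁻¹ * w k) P ?_
  ext γ
  rw [coeff_sum]
  simp only [coeff_smul, smul_eq_mul]
  by_cases hγ : γ.degree = d
  · simp only [coeff_lin_pow _ d γ hγ]
    have e1 : ∑ k, ((Nat.multinomial Finset.univ A : ℂ) * K)⁻¹ * w k *
        ((Nat.multinomial Finset.univ γ : ℂ) * ∏ i, P k i ^ γ i) =
        ((Nat.multinomial Finset.univ A : ℂ) * K)⁻¹ * (Nat.multinomial Finset.univ γ : ℂ) *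
          ∑ k, w k * ∏ i, P k i ^ γ i := by
      rw [Finset.mul_sum]
      exact Finset.sum_congr rfl fun k _ => by ring
    rw [e1, coeff_monomial]
    split_ifs with h
    · subst h
      rw [← hKdef]
      field_simp
    · rw [hvan γ hγ (Ne.symm h), mul_zero]
  · rw [coeff_monomial, if_neg (by rintro rfl; exact hγ hA)]
    symm
    refine Finset.sum_eq_zero fun k _ => ?_
    have hh := (lin_isHomogeneous (P k)).pow d
    rw [one_mul] at hh
    rw [hh.coeff_eq_zero hγ, mul_zero]

/-- If there are more monomials than points off the hyperplane `ℓ = 0`, then there is a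
homogeneous relation modulo `ℓ` on these points. -/
theorem exists_relation {σ ι : Type*} [Fintype ι]
    (p : ι → σ → ℂ) (ℓ : MvPolynomial σ ℂ) (hℓ : ℓ.IsHomogeneous 1) (S : Finset (σ →₀ ℕ))
    (hS : Fintype.card {j // eval (p j) ℓ ≠ 0} < S.card) :
    ∃ (k : ℕ) (c : (σ →₀ ℕ) → ℂ) (u : MvPolynomial σ ℂ), u.IsHomogeneous (k - 1) ∧
      (∑ γ ∈ S with γ.degree = k, monomial γ (c γ) + ℓ * u).IsHomogeneous k ∧
      (∀ j, eval (p j) ℓ ≠ 0 →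
        eval (p j) (∑ γ ∈ S with γ.degree = k, monomial γ (c γ) + ℓ * u) = 0) ∧
      ∃ γ ∈ S, γ.degree = k ∧ c γ ≠ 0 := by
  let v : S → {j // eval (p j) ℓ ≠ 0} → ℂ := fun γ j =>
    eval (p j) (monomial γ.1 (1 : ℂ)) / (eval (p j) ℓ) ^ γ.1.degree
  have hdep : ¬ LinearIndependent ℂ v := by
    intro h
    have := h.fintype_card_le_finrank
    rw [Module.finrank_fintype_fun_eq_card, Fintype.card_coe] at this
    omega
  obtain ⟨c', hc', i0, hi0⟩ := Fintype.not_linearIndependent_iff.1 hdep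
  classical
  let c : (σ →₀ ℕ) → ℂ := fun γ => if h : γ ∈ S then c' ⟨γ, h⟩ else 0
  have hrel : ∀ j, eval (p j) ℓ ≠ 0 →
      ∑ γ ∈ S, c γ * (eval (p j) (monomial γ (1 : ℂ)) / (eval (p j) ℓ) ^ γ.degree) = 0 := by
    intro j hj
    have := congrFun hc' ⟨j, hj⟩
    rw [Finset.sum_apply] at this
    rw [← Finset.sum_coe_sort]
    simpa [c, v] using this
  obtain ⟨γ0, hγ0, hmax⟩ := Finset.exists_max_image (S.filter fun γ => c γ ≠ 0) Finsupp.degree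
    ⟨i0.1, by simp [c, hi0]⟩
  rw [Finset.mem_filter] at hγ0
  set k := γ0.degree with hk
  have hzero : ∀ γ ∈ S, k < γ.degree → c γ = 0 := by
    intro γ hγ hlt
    by_contra hne
    have := hmax γ (Finset.mem_filter.2 ⟨hγ, hne⟩)
    omega
  refine ⟨k, c, ∑ γ ∈ S with γ.degree < k, ℓ ^ (k - 1 - γ.degree) * monomial γ (c γ),
    ?_, ?_, ?_, γ0, hγ0.1, rfl, hγ0.2⟩
  · refine IsHomogeneous.sum _ _ _ fun γ hγ => ?_
    have h1 := (hℓ.pow (k - 1 - γ.degree)).mul (isHomogeneous_monomial (c γ) (d := γ) rfl)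
    have h2 := (Finset.mem_filter.1 hγ).2
    convert h1 using 1
    omega
  · refine IsHomogeneous.add (IsHomogeneous.sum _ _ _ fun γ hγ =>
      isHomogeneous_monomial _ (Finset.mem_filter.1 hγ).2) ?_
    rw [Finset.mul_sum]
    refine IsHomogeneous.sum _ _ _ fun γ hγ => ?_
    have h1 := hℓ.mul ((hℓ.pow (k - 1 - γ.degree)).mul
      (isHomogeneous_monomial (c γ) (d := γ) rfl))
    have h2 := (Finset.mem_filter.1 hγ).2
    convert h1 using 1
    omega
  · intro j hj
    have h0 := congrArg (fun z => (eval (p j) ℓ) ^ k * z) (hrel j hj)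
    simp only [mul_zero, Finset.mul_sum] at h0
    rw [← h0, map_add, map_mul, map_sum, map_sum, Finset.mul_sum, Finset.sum_filter,
      Finset.sum_filter, ← Finset.sum_add_distrib]
    refine Finset.sum_congr rfl fun γ hγ => ?_
    have hmon : eval (p j) (monomial γ (c γ)) = c γ * eval (p j) (monomial γ (1 : ℂ)) := by
      simp [eval_monomial]
    rcases lt_trichotomy γ.degree k with h | h | h
    · rw [if_neg h.ne, if_pos h, zero_add, map_mul, map_pow, hmon]
      have : (eval (p j) ℓ) ^ k = eval (p j) ℓ * (eval (p j) ℓ) ^ (k - 1 - γ.degree) *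
          (eval (p j) ℓ) ^ γ.degree := by
        rw [← pow_succ', ← pow_add]
        congr 1
        omega
      rw [this]
      field_simp
    · rw [if_pos h, if_neg (by omega), add_zero, hmon, h]
      field_simp
    · rw [if_neg (by omega), if_neg (by omega), hzero γ hγ h]
      simp

theorem coeff_filter_sum {σ : Type*} [DecidableEq σ] (S : Finset (σ →₀ ℕ)) (k : ℕ)
    (c : (σ →₀ ℕ) → ℂ) (γ : σ →₀ ℕ) :
    coeff γ (∑ δ ∈ S with δ.degree = k, monomial δ (c δ)) =
      if γ ∈ S ∧ γ.degree = k then c γ else 0 := by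
  rw [coeff_sum]
  simp only [coeff_monomial, Finset.sum_ite_eq', Finset.mem_filter]

theorem coeff_X_mul_zero {σ : Type*} (γ : σ →₀ ℕ) (i : σ) (h : γ i = 0)
    (g : MvPolynomial σ ℂ) : coeff γ (X i * g) = 0 := by
  classical
  rw [coeff_X_mul', if_neg (by simp [h])]

/-- The basic data: a finite weighted point set with the moments of `x^A + x^B`. -/
structure Conf {σ ι : Type*} [Fintype ι] (d : ℕ) (A B : σ →₀ ℕ) (x0 y0 : σ)
    (p : ι → σ → ℂ) : Prop where
  degA : A.degree = d
  degB : B.degree = d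
  d3 : 3 ≤ d
  hx0 : 1 ≤ A x0
  hy0 : 1 ≤ B y0
  disj : ∀ i, A i = 0 ∨ B i = 0
  cov : ∀ i, 1 ≤ A i ∨ 1 ≤ B i
  mom : ∃ (c : ι → ℂ) (κ₁ κ₂ : ℂ), κ₁ ≠ 0 ∧ κ₂ ≠ 0 ∧ ∀ g : MvPolynomial σ ℂ, g.IsHomogeneous d →
      ∑ j, c j * eval (p j) g = κ₁ * coeff A g + κ₂ * coeff B g

section conf
set_option linter.unusedSectionVars false
variable {σ ι : Type*} [Fintype σ] [DecidableEq σ] [Fintype ι] {d : ℕ} {A B : σ →₀ ℕ} {x0 y0 : σ}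
  {p : ι → σ → ℂ}

theorem Conf.symm (h : Conf d A B x0 y0 p) : Conf d B A y0 x0 p := by
  obtain ⟨c, κ₁, κ₂, h1, h2, h3⟩ := h.mom
  exact ⟨h.degB, h.degA, h.d3, h.hy0, h.hx0, fun i => (h.disj i).symm, fun i => (h.cov i).symm,
    c, κ₂, κ₁, h2, h1, fun g hg => by rw [h3 g hg, add_comm]⟩

theorem Conf.Bx0 (h : Conf d A B x0 y0 p) : B x0 = 0 := by
  have := h.disj x0
  have := h.hx0
  omega

theorem Conf.Ay0 (h : Conf d A B x0 y0 p) : A y0 = 0 := h.symm.Bx0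

theorem Conf.ne (h : Conf d A B x0 y0 p) : x0 ≠ y0 := by
  intro e
  have := h.Bx0
  have := h.hy0
  rw [← e] at this
  omega

/-- Apolarity: forms vanishing on the points have no coefficient along divisors of `x^A`. -/
theorem Conf.coeffA (h : Conf d A B x0 y0 p) (g : MvPolynomial σ ℂ) (γ : σ →₀ ℕ) (hγ : γ ≤ A)
    (hg : g.IsHomogeneous γ.degree) (hv : ∀ j, eval (p j) g = 0) (hB : coeff B g = 0) :
    coeff γ g = 0 := by
  obtain ⟨c, κ₁, κ₂, h1, h2, h3⟩ := h.mom
  have hdeg : γ.degree + (A - γ).degree = d := by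
    rw [← map_add, add_tsub_cancel_of_le hγ, h.degA]
  have h4 := h3 (g * monomial (A - γ) 1) (by
    rw [← hdeg]
    exact hg.mul (isHomogeneous_monomial _ rfl))
  have h5 : coeff B (g * monomial (A - γ) (1 : ℂ)) = 0 := by
    rw [coeff_mul_monomial']
    split_ifs with hle
    · have h0 : A - γ = 0 := by
        ext i
        have e1 := hle i
        have e2 := h.disj i
        rw [Finsupp.tsub_apply] at e1
        simp only [Finsupp.tsub_apply, Finsupp.coe_zero, Pi.zero_apply]
        omega
      rw [h0, tsub_zero, hB, zero_mul]
    · rfl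
  have h6 : coeff A (g * monomial (A - γ) (1 : ℂ)) = coeff γ g := by
    rw [coeff_mul_monomial', if_pos tsub_le_self, mul_one]
    congr 1
    exact tsub_tsub_cancel_of_le hγ
  rw [h5, h6] at h4
  simp only [map_mul, hv, zero_mul, mul_zero, Finset.sum_const_zero, add_zero] at h4
  exact (mul_eq_zero.1 h4.symm).resolve_left h1

theorem mem_S {A : σ →₀ ℕ} {x0 : σ} {α : σ →₀ ℕ} :
    α ∈ Finset.Iic (A.erase x0) ↔ α ≤ A ∧ α x0 = 0 := by
  rw [Finset.mem_Iic]
  constructor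
  · intro h
    refine ⟨fun i => (h i).trans ?_, ?_⟩
    · by_cases hi : i = x0
      · subst hi; simp
      · rw [Finsupp.erase_ne hi]
    · have := h x0
      rw [Finsupp.erase_same] at this
      omega
  · rintro ⟨h1, h2⟩ i
    by_cases hi : i = x0
    · subst hi; simp [h2]
    · rw [Finsupp.erase_ne hi]; exact h1 i

theorem add_single_le (h : Conf d A B x0 y0 p) {α : σ →₀ ℕ} (hα : α ∈ Finset.Iic (A.erase x0)) :
    Finsupp.single x0 1 + α ≤ A := by
  obtain ⟨h1, h2⟩ := mem_S.1 hα
  intro i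
  by_cases hi : i = x0
  · subst hi
    have := h.hx0
    simp [h2]; omega
  · have e : (Finsupp.single x0 1 : σ →₀ ℕ) i = 0 := Finsupp.single_eq_of_ne hi
    rw [Finsupp.add_apply, e, zero_add]
    exact h1 i

theorem mem_S_y0 (h : Conf d A B x0 y0 p) {α : σ →₀ ℕ} (hα : α ∈ Finset.Iic (A.erase x0)) :
    α y0 = 0 := by
  have h1 := (mem_S.1 hα).1 y0
  rw [h.Ay0] at h1
  omega

/-- If `X₀ g` vanishes on the points, the coefficients of `g` in `S_A` vanish. -/
theorem Conf.coeffS (h : Conf d A B x0 y0 p) {α : σ →₀ ℕ} (hα : α ∈ Finset.Iic (A.erase x0))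
    (g : MvPolynomial σ ℂ) (hg : g.IsHomogeneous α.degree)
    (hv : ∀ j, p j x0 ≠ 0 → eval (p j) g = 0) : coeff α g = 0 := by
  rw [← coeff_X_mul α x0 g]
  refine h.coeffA _ _ (add_single_le h hα) ?_ ?_ (coeff_X_mul_zero _ _ h.Bx0 _)
  · rw [map_add, Finsupp.degree_single]
    exact (isHomogeneous_X _ _).mul hg
  · intro j
    rw [map_mul, eval_X]
    by_cases h0 : p j x0 = 0
    · rw [h0, zero_mul]
    · rw [hv j h0, mul_zero]

theorem Conf.card_x0 (h : Conf d A B x0 y0 p) :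
    (Finset.Iic (A.erase x0)).card ≤ Fintype.card {j // eval (p j) (X x0 : MvPolynomial σ ℂ) ≠ 0} := by
  by_contra hlt
  obtain ⟨k, c, u, hu, hg, hv, γ, hγ, hk, hc⟩ := exists_relation p (X x0) (isHomogeneous_X _ _)
    (Finset.Iic (A.erase x0)) (not_le.1 hlt)
  subst hk
  have h1 := h.coeffS hγ _ hg (fun j hj => hv j (by simpa using hj))
  rw [coeff_add, coeff_filter_sum, if_pos ⟨hγ, rfl⟩,
    coeff_X_mul_zero _ _ (mem_S.1 hγ).2, add_zero] at h1
  exact hc h1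

theorem Conf.linear_x0 (h : Conf d A B x0 y0 p)
    (hcard : Fintype.card {j // eval (p j) (X x0 : MvPolynomial σ ℂ) ≠ 0} ≤
      (Finset.Iic (A.erase x0)).card) (i : σ) (hi : 1 ≤ B i) :
    ∃ s : ℂ, ∀ j, p j x0 ≠ 0 → p j i = s * p j x0 := by
  have hAi : A i = 0 := by have := h.disj i; omega
  have hnot : Finsupp.single i 1 ∉ Finset.Iic (A.erase x0) := by
    intro hm
    have := (mem_S.1 hm).1 i
    rw [Finsupp.single_eq_same] at this
    omega
  obtain ⟨k, c, u, hu, hg, hv, γ, hγ, hk, hc⟩ := exists_relation p (X x0) (isHomogeneous_X _ _)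
    (insert (Finsupp.single i 1) (Finset.Iic (A.erase x0)))
    (by rw [Finset.card_insert_of_notMem hnot]; omega)
  subst hk
  have hα : ∀ α ∈ Finset.Iic (A.erase x0), α.degree = γ.degree → c α = 0 := by
    intro α hα he
    have h1 := h.coeffS hα _ (he ▸ hg) (fun j hj => hv j (by simpa using hj))
    rwa [coeff_add, coeff_filter_sum, if_pos ⟨Finset.mem_insert_of_mem hα, he⟩,
      coeff_X_mul_zero _ _ (mem_S.1 hα).2, add_zero] at h1
  have hγi : γ = Finsupp.single i 1 := by
    rcases Finset.mem_insert.1 hγ with h1 | h1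
    · exact h1
    · exact absurd (hα γ h1 rfl) hc
  have hsum : ∑ δ ∈ insert (Finsupp.single i 1) (Finset.Iic (A.erase x0)) with
      δ.degree = γ.degree, monomial δ (c δ) = monomial γ (c γ) := by
    refine Finset.sum_eq_single_of_mem γ (Finset.mem_filter.2 ⟨hγ, rfl⟩) fun δ hδ hne => ?_
    obtain ⟨h1, h2⟩ := Finset.mem_filter.1 hδ
    rcases Finset.mem_insert.1 h1 with h3 | h3
    · exact absurd (h3.trans hγi.symm) hne
    · rw [hα δ h3 h2, monomial_zero]
  rw [hsum] at hv
  have hu0 : u.IsHomogeneous 0 := by simpa [hγi] using hu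
  have hu1 := totalDegree_eq_zero_iff_eq_C.1 ((totalDegree_zero_iff_isHomogeneous σ).2 hu0)
  refine ⟨-(coeff 0 u) / c γ, fun j hj => ?_⟩
  have h1 := hv j (by simpa using hj)
  rw [hu1, hγi, map_add, map_mul, eval_X, eval_C, eval_monomial,
    Finsupp.prod_single_index (by simp), pow_one, ← hγi] at h1
  field_simp
  linear_combination h1

/-- The linear form `u X₀ + v Y₀`. -/
def ell (x0 y0 : σ) (u v : ℂ) : MvPolynomial σ ℂ := C u * X x0 + C v * X y0

theorem ell_hom (x0 y0 : σ) (u v : ℂ) : (ell x0 y0 u v).IsHomogeneous 1 :=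
  (isHomogeneous_C_mul_X _ _).add (isHomogeneous_C_mul_X _ _)

theorem eval_ell (x0 y0 : σ) (u v : ℂ) (q : σ → ℂ) :
    eval q (ell x0 y0 u v) = u * q x0 + v * q y0 := by simp [ell]

theorem coeff_ell_mul (x0 y0 : σ) (u v : ℂ) (g : MvPolynomial σ ℂ) (δ : σ →₀ ℕ) :
    coeff δ (ell x0 y0 u v * g) = u * coeff δ (X x0 * g) + v * coeff δ (X y0 * g) := by
  rw [ell, add_mul, mul_assoc, mul_assoc, coeff_add, coeff_C_mul, coeff_C_mul]

theorem coeff_ell_mul_zero (x0 y0 : σ) (u v : ℂ) (g : MvPolynomial σ ℂ) (δ : σ →₀ ℕ)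
    (hx : δ x0 = 0) (hy : δ y0 = 0) : coeff δ (ell x0 y0 u v * g) = 0 := by
  rw [coeff_ell_mul, coeff_X_mul_zero _ _ hx, coeff_X_mul_zero _ _ hy]; simp

theorem eq_of_le_of_degree {γ A : σ →₀ ℕ} (h : γ ≤ A) (hd : A.degree ≤ γ.degree) : γ = A := by
  have h1 : γ.degree + (A - γ).degree = A.degree := by
    rw [← map_add, add_tsub_cancel_of_le h]
  have h2 : (A - γ).degree = 0 := by omega
  have h3 := (Finsupp.degree_eq_zero_iff _).1 h2
  exact le_antisymm h (tsub_eq_zero_iff_le.1 h3)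

theorem Conf.card_union (h : Conf d A B x0 y0 p) :
    (Finset.Iic (A.erase x0)).card + (Finset.Iic (B.erase y0)).card ≤
      (Finset.Iic (A.erase x0) ∪ Finset.Iic (B.erase y0)).card + 1 := by
  rw [← Finset.card_union_add_card_inter]
  have : (Finset.Iic (A.erase x0) ∩ Finset.Iic (B.erase y0)).card ≤ 1 := by
    rw [Finset.card_le_one]
    have hz : ∀ γ ∈ Finset.Iic (A.erase x0) ∩ Finset.Iic (B.erase y0), γ = 0 := by
      intro γ hγ
      rw [Finset.mem_inter, mem_S, mem_S] at hγ
      ext i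
      have h1 := hγ.1.1 i
      have h2 := hγ.2.1 i
      have h3 := h.disj i
      simp only [Finsupp.coe_zero, Pi.zero_apply]
      omega
    intro a ha b hb
    rw [hz a ha, hz b hb]
  omega

theorem Conf.card_mixed (h : Conf d A B x0 y0 p) (hA1 : A x0 = 1) (u v : ℂ) (hu : u ≠ 0)
    (hv : v ≠ 0) :
    (Finset.Iic (A.erase x0)).card + (Finset.Iic (B.erase y0)).card ≤
      Fintype.card {j // eval (p j) (ell x0 y0 u v) ≠ 0} + 2 := by
  by_contra hlt
  have hun := h.card_union
  obtain ⟨T, hT⟩ : ∃ T, T = A - Finsupp.single x0 1 := ⟨_, rfl⟩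
  have hTA : Finsupp.single x0 1 + T = A := by
    rw [hT]
    refine add_tsub_cancel_of_le ?_
    rw [Finsupp.single_le_iff]
    exact h.hx0
  have hTx : T x0 = 0 := by rw [hT, Finsupp.tsub_apply, hA1, Finsupp.single_eq_same]
  have hTy : T y0 = 0 := by rw [hT, Finsupp.tsub_apply, h.Ay0, Nat.zero_sub]
  obtain ⟨k, c, w, hw, hg, hvan, γ, hγ, hk, hc⟩ := exists_relation p (ell x0 y0 u v)
    (ell_hom _ _ _ _) ((Finset.Iic (A.erase x0) ∪ Finset.Iic (B.erase y0)).erase T) (by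
      have := Finset.pred_card_le_card_erase
        (s := Finset.Iic (A.erase x0) ∪ Finset.Iic (B.erase y0)) (a := T)
      omega)
  subst hk
  obtain ⟨g, hgdef⟩ : ∃ g, g = ∑ δ ∈ (Finset.Iic (A.erase x0) ∪ Finset.Iic (B.erase y0)).erase T
    with δ.degree = γ.degree, monomial δ (c δ) + ell x0 y0 u v * w := ⟨_, rfl⟩
  rw [← hgdef] at hg hvan
  have hcoef : ∀ δ : σ →₀ ℕ, δ x0 = 0 → δ y0 = 0 → coeff δ g =
      if δ ∈ (Finset.Iic (A.erase x0) ∪ Finset.Iic (B.erase y0)).erase T ∧ δ.degree = γ.degree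
        then c δ else 0 := by
    intro δ h1 h2
    rw [hgdef, coeff_add, coeff_filter_sum, coeff_ell_mul_zero _ _ _ _ _ _ h1 h2, add_zero]
  have hall : ∀ j, eval (p j) (ell x0 y0 u v * g) = 0 := by
    intro j
    rw [map_mul]
    by_cases h0 : eval (p j) (ell x0 y0 u v) = 0
    · rw [h0, zero_mul]
    · rw [hvan j h0, mul_zero]
  have hlg : (ell x0 y0 u v * g).IsHomogeneous (1 + γ.degree) := (ell_hom _ _ _ _).mul hg
  have hγ' := hγ
  rw [Finset.mem_erase, Finset.mem_union] at hγ'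
  obtain ⟨hne, hα | hβ⟩ := hγ'
  · have hle := add_single_le h hα
    have hx := (mem_S.1 hα).2
    have hy := mem_S_y0 h hα
    have h1 := h.coeffA (ell x0 y0 u v * g) (Finsupp.single x0 1 + γ) hle
      (by rw [map_add, Finsupp.degree_single]; exact hlg) hall (by
        refine hlg.coeff_eq_zero ?_
        intro hd
        have h2 : Finsupp.single x0 1 + γ = A := eq_of_le_of_degree hle (by
          rw [map_add, Finsupp.degree_single, ← hd, h.degA, h.degB])
        rw [← hTA] at h2
        exact hne (add_left_cancel h2))
    rw [coeff_ell_mul, coeff_X_mul, coeff_X_mul_zero _ y0 (by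
      rw [Finsupp.add_apply, hy, Finsupp.single_eq_of_ne h.ne.symm]), mul_zero, add_zero,
      hcoef γ hx hy, if_pos ⟨hγ, rfl⟩] at h1
    exact (mul_ne_zero hu hc) h1
  · have hle := add_single_le h.symm hβ
    have hy := (mem_S.1 hβ).2
    have hx := mem_S_y0 h.symm hβ
    have h1 := h.symm.coeffA (ell x0 y0 u v * g) (Finsupp.single y0 1 + γ) hle
      (by rw [map_add, Finsupp.degree_single]; exact hlg) hall (by
        rw [coeff_ell_mul, coeff_X_mul_zero _ y0 h.Ay0, ← hTA, coeff_X_mul, hcoef T hTx hTy,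
          if_neg (by simp)]
        simp)
    rw [coeff_ell_mul, coeff_X_mul, coeff_X_mul_zero _ x0 (by
      rw [Finsupp.add_apply, hx, Finsupp.single_eq_of_ne h.ne]), mul_zero, zero_add,
      hcoef γ hx hy, if_pos ⟨hγ, rfl⟩] at h1
    exact (mul_ne_zero hv hc) h1

theorem Conf.no_linear (h : Conf d A B x0 y0 p) (u v : ℂ)
    (hv : ∀ j, u * p j x0 + v * p j y0 = 0) : u = 0 ∧ v = 0 := by
  have hd := h.d3
  have hc : ∀ δ : σ →₀ ℕ, δ.degree = d → coeff δ (ell x0 y0 u v) = 0 := fun δ hδ =>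
    (ell_hom x0 y0 u v).coeff_eq_zero (by omega)
  have h1 := h.coeffA (ell x0 y0 u v) (Finsupp.single x0 1)
    (by rw [Finsupp.single_le_iff]; exact h.hx0)
    (by rw [Finsupp.degree_single]; exact ell_hom _ _ _ _)
    (fun j => by rw [eval_ell]; exact hv j) (hc B h.degB)
  have h2 := h.symm.coeffA (ell x0 y0 u v) (Finsupp.single y0 1)
    (by rw [Finsupp.single_le_iff]; exact h.hy0)
    (by rw [Finsupp.degree_single]; exact ell_hom _ _ _ _)
    (fun j => by rw [eval_ell]; exact hv j) (hc A h.degA)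
  have e1 : coeff (Finsupp.single x0 1) (X x0 : MvPolynomial σ ℂ) = 1 := by rw [coeff_X, if_pos rfl]
  have e2 : coeff (Finsupp.single y0 1) (X y0 : MvPolynomial σ ℂ) = 1 := by rw [coeff_X, if_pos rfl]
  have e3 : coeff (Finsupp.single x0 1) (X y0 : MvPolynomial σ ℂ) = 0 := by
    have := coeff_X_mul_zero (Finsupp.single x0 1) y0 (Finsupp.single_eq_of_ne h.ne.symm) 1
    rwa [mul_one] at this
  have e4 : coeff (Finsupp.single y0 1) (X x0 : MvPolynomial σ ℂ) = 0 := by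
    have := coeff_X_mul_zero (Finsupp.single y0 1) x0 (Finsupp.single_eq_of_ne h.ne) 1
    rwa [mul_one] at this
  rw [ell, coeff_add, coeff_C_mul, coeff_C_mul, e1, e3] at h1
  rw [ell, coeff_add, coeff_C_mul, coeff_C_mul, e2, e4] at h2
  constructor
  · simpa using h1
  · simpa using h2

theorem Conf.exists_quad (h : Conf d A B x0 y0 p) (t : ℂ) (ht0 : t ≠ 0)
    (ht : ∀ j, eval (p j) (ell x0 y0 1 t) = 0 → p j x0 = 0 ∧ p j y0 = 0)
    (hcard : Fintype.card ι ≤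
      (Finset.Iic (A.erase x0)).card + (Finset.Iic (B.erase y0)).card) :
    ∃ w : MvPolynomial σ ℂ, w.IsHomogeneous 1 ∧
      ∀ j, eval (p j) (X x0 * X y0 + ell x0 y0 1 t * w) = 0 := by
  have hun := h.card_union
  obtain ⟨U, hU⟩ : ∃ U, U = Finset.Iic (A.erase x0) ∪ Finset.Iic (B.erase y0) := ⟨_, rfl⟩
  rw [← hU] at hun
  have hUx : ∀ δ ∈ U, δ x0 = 0 := by
    intro δ hδ
    rw [hU, Finset.mem_union] at hδ
    rcases hδ with hδ | hδ
    · exact (mem_S.1 hδ).2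
    · exact mem_S_y0 h.symm hδ
  have hUy : ∀ δ ∈ U, δ y0 = 0 := by
    intro δ hδ
    rw [hU, Finset.mem_union] at hδ
    rcases hδ with hδ | hδ
    · exact mem_S_y0 h hδ
    · exact (mem_S.1 hδ).2
  have hn1 : Finsupp.single x0 1 + Finsupp.single y0 1 ∉ U := by
    intro hm
    have := hUx _ hm
    simp at this
  have hn2 : Finsupp.single x0 1 ∉ insert (Finsupp.single x0 1 + Finsupp.single y0 1) U := by
    intro hm
    rcases Finset.mem_insert.1 hm with hm | hm
    · have := congrArg Finsupp.degree hm
      simp at this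
    · have := hUx _ hm
      simp at this
  obtain ⟨k, c, w, hw, hg, hvan, γ, hγ, hk, hc⟩ := exists_relation p (ell x0 y0 1 t)
    (ell_hom _ _ _ _)
    (insert (Finsupp.single x0 1) (insert (Finsupp.single x0 1 + Finsupp.single y0 1) U)) (by
      rw [Finset.card_insert_of_notMem hn2, Finset.card_insert_of_notMem hn1]
      have := Fintype.card_subtype_le (fun j => eval (p j) (ell x0 y0 1 t) ≠ 0)
      omega)
  subst hk
  have hUc : ∀ δ ∈ U, δ.degree = γ.degree → c δ = 0 := by
    intro δ hδ he
    have hm : δ ∈ insert (Finsupp.single x0 1)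
      (insert (Finsupp.single x0 1 + Finsupp.single y0 1) U) :=
      Finset.mem_insert_of_mem (Finset.mem_insert_of_mem hδ)
    have h0 := hδ
    rw [hU, Finset.mem_union] at h0
    rcases h0 with h0 | h0
    · have h1 := h.coeffS h0 _ (he ▸ hg) (fun j hj => hvan j (fun hz => hj (ht j hz).1))
      rwa [coeff_add, coeff_filter_sum, if_pos ⟨hm, he⟩,
        coeff_ell_mul_zero _ _ _ _ _ _ (hUx _ hδ) (hUy _ hδ), add_zero] at h1
    · have h1 := h.symm.coeffS h0 _ (he ▸ hg) (fun j hj => hvan j (fun hz => hj (ht j hz).2))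
      rwa [coeff_add, coeff_filter_sum, if_pos ⟨hm, he⟩,
        coeff_ell_mul_zero _ _ _ _ _ _ (hUx _ hδ) (hUy _ hδ), add_zero] at h1
  have hγ' : γ = Finsupp.single x0 1 ∨ γ = Finsupp.single x0 1 + Finsupp.single y0 1 := by
    rcases Finset.mem_insert.1 hγ with h1 | h1
    · exact Or.inl h1
    · rcases Finset.mem_insert.1 h1 with h2 | h2
      · exact Or.inr h2
      · exact absurd (hUc γ h2 rfl) hc
  have hsum : ∑ δ ∈ insert (Finsupp.single x0 1)
      (insert (Finsupp.single x0 1 + Finsupp.single y0 1) U) with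
      δ.degree = γ.degree, monomial δ (c δ) = monomial γ (c γ) := by
    refine Finset.sum_eq_single_of_mem γ (Finset.mem_filter.2 ⟨hγ, rfl⟩) fun δ hδ hne => ?_
    obtain ⟨h1, h2⟩ := Finset.mem_filter.1 hδ
    have h3 : δ ∈ U := by
      rcases Finset.mem_insert.1 h1 with h3 | h3
      · rcases hγ' with h4 | h4
        · exact absurd (h3.trans h4.symm) hne
        · rw [h3, h4] at h2; simp at h2
      · rcases Finset.mem_insert.1 h3 with h3 | h3
        · rcases hγ' with h4 | h4
          · rw [h3, h4] at h2; simp at h2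
          · exact absurd (h3.trans h4.symm) hne
        · exact h3
    rw [hUc δ h3 h2, monomial_zero]
  rw [hsum] at hvan
  rcases hγ' with h1 | h1
  · exfalso
    have hu0 : w.IsHomogeneous 0 := by simpa [h1] using hw
    have hu1 := totalDegree_eq_zero_iff_eq_C.1 ((totalDegree_zero_iff_isHomogeneous σ).2 hu0)
    have hl := h.no_linear (c γ + coeff 0 w) (t * coeff 0 w) (by
      intro j
      by_cases hz : eval (p j) (ell x0 y0 1 t) = 0
      · rw [(ht j hz).1, (ht j hz).2]; simp
      · have h2 := hvan j hz
        rw [hu1, map_add, map_mul, eval_ell, eval_C, eval_monomial, h1,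
          Finsupp.prod_single_index (by simp), pow_one, ← h1] at h2
        linear_combination h2)
    have h3 : coeff 0 w = 0 := (mul_eq_zero.1 hl.2).resolve_left ht0
    rw [h3, add_zero] at hl
    exact hc hl.1
  · refine ⟨C (c γ)⁻¹ * w, ?_, fun j => ?_⟩
    · have : w.IsHomogeneous 1 := by simpa [h1] using hw
      simpa using (isHomogeneous_C σ (c γ)⁻¹).mul this
    · by_cases hz : eval (p j) (ell x0 y0 1 t) = 0
      · rw [map_add, map_mul, map_mul, hz, eval_X, (ht j hz).1]; simp
      · have h2 := hvan j hz
        have h3 : eval (p j) (monomial γ (c γ)) = c γ * (p j x0 * p j y0) := by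
          have e : (monomial γ (c γ) : MvPolynomial σ ℂ) = C (c γ) * (X x0 * X y0) := by
            rw [X, X, monomial_mul, C_mul_monomial, ← h1]
            simp
          rw [e]; simp
        rw [map_add, h3, map_mul] at h2
        simp only [map_add, map_mul, eval_X, eval_C]
        field_simp
        linear_combination h2

theorem coeff_single_X_ne {i j : σ} (h : j ≠ i) :
    coeff (Finsupp.single i 1) (X j : MvPolynomial σ ℂ) = 0 := by
  have := coeff_X_mul_zero (Finsupp.single i 1) j (Finsupp.single_eq_of_ne h) 1
  rwa [mul_one] at this

theorem eval_linear (w : MvPolynomial σ ℂ) (hw : w.IsHomogeneous 1) (q : σ → ℂ) :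
    eval q w = ∑ i, coeff (Finsupp.single i 1) w * q i := by
  have : w = ∑ i, C (coeff (Finsupp.single i 1) w) * X i := by
    ext γ
    by_cases hγ : γ.degree = 1
    · obtain ⟨i, rfl⟩ : ∃ i, Finsupp.single i 1 = γ := by
        have hne : γ ≠ 0 := by
          rintro rfl
          simp at hγ
        obtain ⟨i, hi⟩ := Finsupp.ne_iff.1 hne
        refine ⟨i, eq_of_le_of_degree ?_ (by rw [hγ, Finsupp.degree_single])⟩
        rw [Finsupp.single_le_iff]
        exact Nat.one_le_iff_ne_zero.2 hi
      rw [coeff_sum, Finset.sum_eq_single_of_mem i (Finset.mem_univ _)]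
      · rw [coeff_C_mul, coeff_X, if_pos rfl, mul_one]
      · intro j _ hj
        rw [coeff_C_mul, coeff_single_X_ne hj, mul_zero]
    · rw [hw.coeff_eq_zero hγ]
      symm
      refine (IsHomogeneous.sum _ _ 1 fun i _ => ?_).coeff_eq_zero hγ
      exact isHomogeneous_C_mul_X _ _
  conv_lhs => rw [this]
  simp

theorem single_add_le {x0 i : σ} (hx : 1 ≤ A x0) (hi : 1 ≤ A i) (h2 : x0 = i → 2 ≤ A i) :
    Finsupp.single x0 1 + Finsupp.single i 1 ≤ A := by
  intro l
  rw [Finsupp.add_apply, Finsupp.single_apply, Finsupp.single_apply]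
  split_ifs with e1 e2 e2
  · subst e1
    have := h2 e2.symm
    rw [e2] at this
    omega
  · subst e1; omega
  · subst e2; omega
  · omega

theorem Conf.quad_coeff (h : Conf d A B x0 y0 p) (hA1 : A x0 = 1) (t : ℂ) (ht0 : t ≠ 0)
    (w : MvPolynomial σ ℂ) (hw : w.IsHomogeneous 1)
    (hv : ∀ j, eval (p j) (X x0 * X y0 + ell x0 y0 1 t * w) = 0) :
    ∃ α β : ℂ, (2 ≤ B y0 → β = 0) ∧
      ∀ j, p j x0 * p j y0 + (p j x0 + t * p j y0) * (α * p j x0 + β * p j y0) = 0 := by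
  have hd := h.d3
  have hG : (X x0 * X y0 + ell x0 y0 1 t * w : MvPolynomial σ ℂ).IsHomogeneous (1 + 1) :=
    ((isHomogeneous_X _ _).mul (isHomogeneous_X _ _)).add ((ell_hom _ _ _ _).mul hw)
  have hA : ∀ i, 1 ≤ A i → i ≠ x0 → coeff (Finsupp.single i 1) w = 0 := by
    intro i hi hne
    have hiy : y0 ≠ i := by
      rintro rfl
      have := h.Ay0
      omega
    have h1 := h.coeffA _ (Finsupp.single x0 1 + Finsupp.single i 1)
      (single_add_le h.hx0 hi (fun e => absurd e.symm hne)) (by simpa using hG) hv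
      (hG.coeff_eq_zero (by rw [h.degB]; omega))
    rw [coeff_add, coeff_ell_mul, coeff_X_mul, coeff_X_mul, coeff_single_X_ne hiy,
      coeff_X_mul_zero _ y0 (by
        rw [Finsupp.add_apply, Finsupp.single_eq_of_ne h.ne.symm,
          Finsupp.single_eq_of_ne hiy, add_zero])] at h1
    simpa using h1
  have hB : ∀ i, 1 ≤ B i → (y0 = i → 2 ≤ B i) → coeff (Finsupp.single i 1) w = 0 := by
    intro i hi hne
    have hix : x0 ≠ i := by
      rintro rfl
      have := h.Bx0
      omega
    have hz : (Finsupp.single y0 1 + Finsupp.single i 1 : σ →₀ ℕ) x0 = 0 := by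
        rw [Finsupp.add_apply, Finsupp.single_eq_of_ne h.ne,
          Finsupp.single_eq_of_ne hix, add_zero]
    have h1 := h.symm.coeffA _ (Finsupp.single y0 1 + Finsupp.single i 1)
      (single_add_le h.hy0 hi hne) (by simpa using hG) hv
      (hG.coeff_eq_zero (by rw [h.degA]; omega))
    rw [coeff_add, coeff_ell_mul, coeff_X_mul, coeff_X_mul_zero _ x0 hz,
      coeff_X_mul_zero _ x0 hz] at h1
    simpa [ht0] using h1
  refine ⟨coeff (Finsupp.single x0 1) w, coeff (Finsupp.single y0 1) w,
    fun h2 => hB y0 h.hy0 (fun _ => h2), fun j => ?_⟩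
  have h1 := hv j
  have h2 : eval (p j) w = coeff (Finsupp.single x0 1) w * p j x0 +
      coeff (Finsupp.single y0 1) w * p j y0 := by
    rw [eval_linear w hw]
    rw [← Finset.sum_pair (f := fun i => coeff (Finsupp.single i 1) w * p j i) h.ne]
    symm
    refine Finset.sum_subset (Finset.subset_univ _) fun i _ hi => ?_
    simp only [Finset.mem_insert, Finset.mem_singleton, not_or] at hi
    have : coeff (Finsupp.single i 1) w = 0 := by
      rcases h.cov i with h3 | h3
      · exact hA i h3 hi.1
      · exact hB i h3 (fun e => absurd e.symm hi.2)
    rw [this, zero_mul]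
  rw [map_add, map_mul, map_mul, eval_ell, eval_X, eval_X, h2] at h1
  linear_combination h1

/-- Number of points off the hyperplane `u X₀ + v Y₀ = 0`. -/
def cnt (p : ι → σ → ℂ) (x0 y0 : σ) (u v : ℂ) : ℕ :=
  Fintype.card {j // eval (p j) (ell x0 y0 u v) ≠ 0}

theorem cnt_add_le (u v u' v' : ℂ)
    (hv : ∀ j, (u * p j x0 + v * p j y0) * (u' * p j x0 + v' * p j y0) = 0) :
    cnt p x0 y0 u v + cnt p x0 y0 u' v' ≤ Fintype.card ι := by
  classical
  unfold cnt
  rw [Fintype.card_subtype, Fintype.card_subtype, ← Finset.card_union_of_disjoint]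
  · exact Finset.card_le_univ _
  · rw [Finset.disjoint_filter]
    intro j _ h1 h2
    rw [eval_ell] at h1 h2
    exact (mul_ne_zero h1 h2) (hv j)

theorem cnt_x0 (u : ℂ) (hu : u ≠ 0) :
    cnt p x0 y0 u 0 = Fintype.card {j // eval (p j) (X x0 : MvPolynomial σ ℂ) ≠ 0} := by
  unfold cnt
  refine Fintype.card_congr (Equiv.subtypeEquivRight fun j => ?_)
  rw [eval_ell, eval_X]
  simp [hu]

theorem cnt_y0 (v : ℂ) (hv : v ≠ 0) :
    cnt p x0 y0 0 v = Fintype.card {j // eval (p j) (X y0 : MvPolynomial σ ℂ) ≠ 0} := by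
  unfold cnt
  refine Fintype.card_congr (Equiv.subtypeEquivRight fun j => ?_)
  rw [eval_ell, eval_X]
  simp [hv]

theorem Conf.card3 (h : Conf d A B x0 y0 p) (hA1 : A x0 = 1) :
    3 ≤ (Finset.Iic (A.erase x0)).card := by
  refine le_trans ?_ (degree_lt_card_Iic _)
  have h1 : (A.erase x0).degree + A x0 = d := by
    have h2 : A.erase x0 + Finsupp.single x0 (A x0) = A := Finsupp.erase_add_single _ _
    have := congrArg Finsupp.degree h2
    rwa [map_add, Finsupp.degree_single, h.degA] at this
  have := h.d3
  omega

theorem Conf.xy_zero (h : Conf d A B x0 y0 p) (hA1 : A x0 = 1)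
    (hcard : Fintype.card ι ≤
      (Finset.Iic (A.erase x0)).card + (Finset.Iic (B.erase y0)).card) (j : ι) :
    p j x0 * p j y0 = 0 := by
  classical
  obtain ⟨t, ht⟩ := Infinite.exists_notMem_finset
    (insert (0 : ℂ) (Finset.univ.image fun j => - p j x0 / p j y0))
  simp only [Finset.mem_insert, Finset.mem_image, Finset.mem_univ, true_and, not_or,
    not_exists] at ht
  obtain ⟨ht0, ht1⟩ := ht
  obtain ⟨w, hw, hv⟩ := h.exists_quad t ht0 (by
    intro j hj
    rw [eval_ell] at hj
    have hy : p j y0 = 0 := by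
      by_contra hy
      apply ht1 j
      rw [div_eq_iff hy]
      linear_combination -hj
    rw [hy] at hj
    exact ⟨by simpa using hj, hy⟩) hcard
  obtain ⟨α, β, hβ, hq⟩ := h.quad_coeff hA1 t ht0 w hw hv
  have hr1 := h.card3 hA1
  have hN10 : ∀ u : ℂ, u ≠ 0 → (Finset.Iic (A.erase x0)).card ≤ cnt p x0 y0 u 0 := by
    intro u hu; rw [cnt_x0 u hu]; exact h.card_x0
  have hN01 : ∀ v : ℂ, v ≠ 0 → (Finset.Iic (B.erase y0)).card ≤ cnt p x0 y0 0 v := by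
    intro v hv; rw [cnt_y0 v hv]; exact h.symm.card_x0
  have hmix : ∀ u v : ℂ, u ≠ 0 → v ≠ 0 →
      (Finset.Iic (A.erase x0)).card + (Finset.Iic (B.erase y0)).card ≤ cnt p x0 y0 u v + 2 :=
    fun u v hu hv => h.card_mixed hA1 u v hu hv
  have hβ0 : β = 0 := by
    by_contra hne
    have hB1 : B y0 = 1 := by
      have := h.hy0
      by_contra h2
      exact hne (hβ (by omega))
    have hr2 := h.symm.card3 hB1
    have h3 : ∀ u : ℂ, 3 ≤ cnt p x0 y0 u 1 := by
      intro u
      by_cases hu : u = 0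
      · rw [hu]; exact hr2.trans (hN01 1 one_ne_zero)
      · have := hmix u 1 hu one_ne_zero
        omega
    have hν : t * β ≠ 0 := mul_ne_zero ht0 hne
    obtain ⟨s, hs⟩ := IsAlgClosed.exists_eq_mul_self (discrim (t * β) (1 + β + t * α) α)
    obtain ⟨ρ, hρ⟩ := exists_quadratic_eq_zero hν ⟨s, hs⟩
    obtain ⟨ρ', hρ'⟩ : ∃ ρ', t * β * (ρ + ρ') = -(1 + β + t * α) :=
      ⟨-(1 + β + t * α) / (t * β) - ρ, by field_simp; ring⟩
    have hprod : ∀ j, (-ρ * p j x0 + 1 * p j y0) * (-ρ' * p j x0 + 1 * p j y0) = 0 := by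
      intro j
      have hrr : t * β * (ρ * ρ') = α := by linear_combination ρ * hρ' - hρ
      have h4 : t * β * ((-ρ * p j x0 + 1 * p j y0) * (-ρ' * p j x0 + 1 * p j y0)) = 0 := by
        linear_combination hq j - (p j x0 * p j y0) * hρ' + (p j x0) ^ 2 * hrr
      exact (mul_eq_zero.1 h4).resolve_left hν
    have hle := cnt_add_le _ _ _ _ hprod
    by_cases h0 : ρ = 0
    · by_cases h0' : ρ' = 0
      · have := (h.no_linear 0 1 (fun j => by
          have := hprod j
          rw [h0, h0'] at this
          simpa using this)).2
        exact one_ne_zero this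
      · have h5 := hmix (-ρ') 1 (neg_ne_zero.2 h0') one_ne_zero
        have h6 := h3 (-ρ)
        omega
    · have h5 := hmix (-ρ) 1 (neg_ne_zero.2 h0) one_ne_zero
      have h6 := h3 (-ρ')
      omega
  subst hβ0
  have hα0 : α = 0 := by
    by_contra hα
    have hprod : ∀ j, (1 * p j x0 + 0 * p j y0) * (α * p j x0 + (1 + t * α) * p j y0) = 0 := by
      intro j
      linear_combination hq j
    by_cases hμ : 1 + t * α = 0
    · have := (h.no_linear 1 0 (fun j => by
          have := hprod j
          rw [hμ] at this
          simpa [hα] using this)).1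
      exact one_ne_zero this
    · have hle := cnt_add_le _ _ _ _ hprod
      have h5 := hmix α (1 + t * α) hα hμ
      have h6 := hN10 1 one_ne_zero
      omega
  subst hα0
  have := hq j
  simpa using this

theorem Conf.slope_zero (h : Conf d A B x0 y0 p)
    (hall : ∀ j, p j x0 ≠ 0 ∨ p j y0 ≠ 0)
    (hA : ∀ i, 1 ≤ A i → ∃ s : ℂ, ∀ j, p j y0 ≠ 0 → p j i = s * p j y0)
    (i : σ) (hi : 1 ≤ B i) (s : ℂ) (hs : ∀ j, p j x0 ≠ 0 → p j i = s * p j x0) : s = 0 := by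
  have hd := h.d3
  have hAi : A i = 0 := by have := h.disj i; omega
  obtain ⟨i', hi'⟩ : ∃ i', Finsupp.single x0 1 + Finsupp.single i' 1 ≤ A := by
    have hle : Finsupp.single x0 1 ≤ A := by rw [Finsupp.single_le_iff]; exact h.hx0
    have hne : A - Finsupp.single x0 1 ≠ 0 := by
      intro h0
      have h1 : (Finsupp.single x0 1 + (A - Finsupp.single x0 1)).degree = d := by
        rw [add_tsub_cancel_of_le hle, h.degA]
      rw [h0, add_zero, Finsupp.degree_single] at h1
      omega
    obtain ⟨i', hi'⟩ := Finsupp.ne_iff.1 hne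
    refine ⟨i', ?_⟩
    have h2 : Finsupp.single i' 1 ≤ A - Finsupp.single x0 1 := by
      rw [Finsupp.single_le_iff]
      exact Nat.one_le_iff_ne_zero.2 hi'
    calc _ ≤ Finsupp.single x0 1 + (A - Finsupp.single x0 1) := by gcongr
      _ = A := add_tsub_cancel_of_le hle
  have hAi' : 1 ≤ A i' := by
    have := hi' i'
    rw [Finsupp.add_apply, Finsupp.single_eq_same] at this
    omega
  obtain ⟨s', hs'⟩ := hA i' hAi'
  have hiy : y0 ≠ i' := by
    rintro rfl
    have := h.Ay0
    omega
  have hγi : (Finsupp.single x0 1 + Finsupp.single i' 1 : σ →₀ ℕ) i = 0 := by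
    have := hi' i
    omega
  have hL : (X i' - C s' * X y0 : MvPolynomial σ ℂ).IsHomogeneous 1 :=
    (isHomogeneous_X _ _).sub (isHomogeneous_C_mul_X _ _)
  have hG : (X i * (X i' - C s' * X y0) - C s * (X x0 * (X i' - C s' * X y0)) :
      MvPolynomial σ ℂ).IsHomogeneous (1 + 1) := by
    refine ((isHomogeneous_X _ _).mul hL).sub ?_
    simpa using (isHomogeneous_C σ s).mul ((isHomogeneous_X ℂ x0).mul hL)
  have h1 := h.coeffA _ _ hi' (by simpa using hG) (by
    intro j
    simp only [map_sub, map_mul, eval_X, eval_C]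
    rcases hall j with hj | hj
    · rw [hs j hj]; ring
    · rw [hs' j hj]; ring) (hG.coeff_eq_zero (by rw [h.degB]; omega))
  rw [coeff_sub, coeff_X_mul_zero _ _ hγi, coeff_C_mul, coeff_X_mul, coeff_sub, coeff_C_mul,
    coeff_single_X_ne hiy, coeff_X, if_pos rfl] at h1
  simpa using h1

/-- The main splitting statement. -/
theorem Conf.main (h : Conf d A B x0 y0 p) (hA1 : A x0 = 1)
    (hcard : Fintype.card ι ≤
      (Finset.Iic (A.erase x0)).card + (Finset.Iic (B.erase y0)).card) :
    Fintype.card ι = (Finset.Iic (A.erase x0)).card + (Finset.Iic (B.erase y0)).card ∧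
    ∀ j, (∀ i, 1 ≤ A i → p j i = 0) ∨ (∀ i, 1 ≤ B i → p j i = 0) := by
  classical
  have hxy := h.xy_zero hA1 hcard
  have hx := h.card_x0
  have hy := h.symm.card_x0
  have hdis : Disjoint (Finset.univ.filter fun j => eval (p j) (X x0 : MvPolynomial σ ℂ) ≠ 0)
      (Finset.univ.filter fun j => eval (p j) (X y0 : MvPolynomial σ ℂ) ≠ 0) := by
    rw [Finset.disjoint_filter]
    intro j _ h1 h2
    rw [eval_X] at h1 h2
    exact (mul_ne_zero h1 h2) (hxy j)
  have hun := Finset.card_union_of_disjoint hdis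
  have hle := Finset.card_le_univ
    ((Finset.univ.filter fun j => eval (p j) (X x0 : MvPolynomial σ ℂ) ≠ 0) ∪
      (Finset.univ.filter fun j => eval (p j) (X y0 : MvPolynomial σ ℂ) ≠ 0))
  have hx' := hx
  have hy' := hy
  rw [Fintype.card_subtype] at hx' hy'
  have hfull : ((Finset.univ.filter fun j => eval (p j) (X x0 : MvPolynomial σ ℂ) ≠ 0) ∪
      (Finset.univ.filter fun j => eval (p j) (X y0 : MvPolynomial σ ℂ) ≠ 0)) = Finset.univ := by
    rw [← Finset.card_eq_iff_eq_univ]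
    omega
  have hall : ∀ j, p j x0 ≠ 0 ∨ p j y0 ≠ 0 := by
    intro j
    have : j ∈ Finset.univ := Finset.mem_univ j
    rw [← hfull] at this
    simpa using this
  have hlx := h.linear_x0 (by rw [Fintype.card_subtype]; omega)
  have hly := h.symm.linear_x0 (by rw [Fintype.card_subtype]; omega)
  refine ⟨by omega, fun j => ?_⟩
  rcases hall j with hj | hj
  · right
    intro i hi
    obtain ⟨s, hs⟩ := hlx i hi
    rw [hs j hj, h.slope_zero hall hly i hi s hs, zero_mul]
  · left
    intro i hi
    obtain ⟨s, hs⟩ := hly i hi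
    rw [hs j hj, h.symm.slope_zero (fun j => (hall j).symm) hlx i hi s hs, zero_mul]

end conf

/-- Extracting the part of a split decomposition supported on the variables of `x^A`. -/
theorem extract {σ ι : Type*} [Fintype σ] [DecidableEq σ] [Fintype ι] [DecidableEq ι] (d : ℕ)
    (hd : d ≠ 0) (A B : σ →₀ ℕ) (hB : B ≠ 0) (hdis : ∀ i, A i = 0 ∨ B i = 0)
    (hcov : ∀ i, 1 ≤ A i ∨ 1 ≤ B i) (c : ι → ℂ) (p : ι → σ → ℂ)
    (h : monomial A (1 : ℂ) + monomial B 1 = ∑ j, c j • lin (p j) ^ d)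
    (hsplit : ∀ j, (∀ i, 1 ≤ A i → p j i = 0) ∨ (∀ i, 1 ≤ B i → p j i = 0)) :
    monomial A (1 : ℂ) = ∑ j : {j // ¬ ∀ i, 1 ≤ A i → p j i = 0}, c j • lin (p j) ^ d := by
  let φ : MvPolynomial σ ℂ →ₐ[ℂ] MvPolynomial σ ℂ := aeval fun i => if A i = 0 then 0 else X i
  have h1 := congrArg φ h
  have hφA : φ (monomial A (1 : ℂ)) = monomial A 1 := by
    rw [aeval_monomial, monomial_eq, map_one, map_one]
    congr 1
    refine Finsupp.prod_congr fun i hi => ?_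
    rw [if_neg (Finsupp.mem_support_iff.1 hi)]
  have hφB : φ (monomial B (1 : ℂ)) = 0 := by
    rw [aeval_monomial, map_one, one_mul]
    obtain ⟨i, hi⟩ := Finsupp.ne_iff.1 hB
    rw [Finsupp.coe_zero, Pi.zero_apply] at hi
    refine Finset.prod_eq_zero (Finsupp.mem_support_iff.2 hi) ?_
    beta_reduce
    rw [if_pos ((hdis i).resolve_right hi), zero_pow hi]
  have hφl : ∀ q : σ → ℂ, φ (lin q) = ∑ i, C (q i) * (if A i = 0 then 0 else X i) := by
    intro q
    unfold lin
    rw [map_sum]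
    refine Finset.sum_congr rfl fun i _ => ?_
    rw [map_mul, aeval_X]
    congr 1
    exact aeval_C _ _
  have hφ0 : ∀ q : σ → ℂ, (∀ i, 1 ≤ A i → q i = 0) → φ (lin q) = 0 := by
    intro q hq
    rw [hφl]
    refine Finset.sum_eq_zero fun i _ => ?_
    split_ifs with h0
    · rw [mul_zero]
    · rw [hq i (Nat.one_le_iff_ne_zero.2 h0), map_zero, zero_mul]
  have hφ1 : ∀ q : σ → ℂ, (∀ i, 1 ≤ B i → q i = 0) → φ (lin q) = lin q := by
    intro q hq
    rw [hφl]
    unfold lin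
    refine Finset.sum_congr rfl fun i _ => ?_
    split_ifs with h0
    · have := hcov i
      rw [hq i (by omega), map_zero, zero_mul, zero_mul]
    · rfl
  rw [map_add, hφA, hφB, add_zero, map_sum] at h1
  rw [h1]
  have h2 : ∀ j, φ (c j • lin (p j) ^ d) =
      if ¬ ∀ i, 1 ≤ A i → p j i = 0 then c j • lin (p j) ^ d else 0 := by
    intro j
    rw [map_smul, map_pow]
    split_ifs with h0
    · rw [hφ0 _ h0, zero_pow hd, smul_zero]
    · rw [hφ1 _ ((hsplit j).resolve_left h0)]
  rw [Finset.sum_congr rfl fun j _ => h2 j, ← Finset.sum_filter]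
  exact (Finset.sum_subtype _ (fun j => by simp) (fun j => c j • lin (p j) ^ d))

/-- Abstract form of the theorem. -/
theorem locus_abstract {σ : Type*} [Fintype σ] [DecidableEq σ] (d : ℕ) (A B : σ →₀ ℕ) (x0 y0 : σ)
    (hd : 3 ≤ d) (hA : A.degree = d) (hB : B.degree = d) (hx0 : A x0 = 1) (hy0 : 1 ≤ B y0)
    (hmin : ∀ i, 1 ≤ B i → B y0 ≤ B i)
    (hdis : ∀ i, A i = 0 ∨ B i = 0) (hcov : ∀ i, 1 ≤ A i ∨ 1 ≤ B i) (L : σ → ℂ) (hL : L ≠ 0) :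
    InWaringLocus d (monomial A (1 : ℂ) + monomial B 1) L ↔
      ((∀ i, 1 ≤ B i → L i = 0) ∧ InWaringLocus d (monomial A (1 : ℂ)) L) ∨
      ((∀ i, 1 ≤ A i → L i = 0) ∧ InWaringLocus d (monomial B (1 : ℂ)) L) := by
  classical
  have hd0 : 0 < d := by omega
  have hA0 : A ≠ 0 := by rintro rfl; simp at hx0
  have hB0 : B ≠ 0 := by rintro rfl; simp at hy0
  have hAB : A ≠ B := by
    rintro rfl
    have := hdis x0
    omega
  have hconf : ∀ {ι : Type} [Fintype ι] (c : ι → ℂ) (p : ι → σ → ℂ),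
      monomial A (1 : ℂ) + monomial B 1 = ∑ j, c j • lin (p j) ^ d → Conf d A B x0 y0 p := by
    intro ι _ c p h
    obtain ⟨κ₁, κ₂, h1, h2, h3⟩ := moments d A B c p h hAB
    exact ⟨hA, hB, hd, hx0.ge, hy0, hdis, hcov, c, κ₁, κ₂, h1, h2, h3⟩
  have hdA := monomial_decomp d A x0 hd0 hA hx0.ge (fun i hi => by omega)
  have hdB := monomial_decomp d B y0 hd0 hB hy0 hmin
  have hrA := waringRank_le hdA
  have hrB := waringRank_le hdB
  have hcomb : ∀ {r s : ℕ} (c₁ : Fin r → ℂ) (c₂ : Fin s → ℂ) (p₁ : Fin r → σ → ℂ)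
      (p₂ : Fin s → σ → ℂ), monomial A (1 : ℂ) = ∑ j, c₁ j • lin (p₁ j) ^ d →
      monomial B (1 : ℂ) = ∑ j, c₂ j • lin (p₂ j) ^ d →
      monomial A (1 : ℂ) + monomial B 1 = ∑ j : Fin r ⊕ Fin s, Sum.elim c₁ c₂ j •
        lin (Sum.elim p₁ p₂ j) ^ d := by
    intro r s c₁ c₂ p₁ p₂ h1 h2
    rw [Fintype.sum_sum_type]
    simp only [Sum.elim_inl, Sum.elim_inr]
    rw [← h1, ← h2]
  obtain ⟨LA, hLA⟩ := hasWaringDecomp_rank hdA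
  obtain ⟨LB, hLB⟩ := hasWaringDecomp_rank hdB
  have hF := hcomb (fun _ => 1) (fun _ => 1) LA LB (by simpa using hLA) (by simpa using hLB)
  have hdF := hasWaringDecomp_of_fintype hd0 _ _ hF
  have hrF := waringRank_le hdF
  rw [Fintype.card_sum, Fintype.card_fin, Fintype.card_fin] at hrF
  obtain ⟨LF, hLF⟩ := hasWaringDecomp_rank hdF
  have hmainF := (hconf (fun _ => 1) LF (by simpa using hLF)).main hx0
    (by rw [Fintype.card_fin]; omega)
  have hrank := hmainF.1
  rw [Fintype.card_fin] at hrank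
  have hrA' : waringRank d (monomial A (1 : ℂ)) = (Finset.Iic (A.erase x0)).card := by omega
  have hrB' : waringRank d (monomial B (1 : ℂ)) = (Finset.Iic (B.erase y0)).card := by omega
  have hsumrank : waringRank d (monomial A (1 : ℂ)) + waringRank d (monomial B (1 : ℂ)) =
    waringRank d (monomial A (1 : ℂ) + monomial B 1) := by omega
  constructor
  · rintro ⟨c, p, j₀, hj₀, h⟩
    have hsplit := ((hconf c p h).main hx0 (by rw [Fintype.card_fin]; omega)).2
    have e1 := extract d hd0.ne' A B hB0 hdis hcov c p h hsplit
    have e2 := extract d hd0.ne' B A hA0 (fun i => (hdis i).symm) (fun i => (hcov i).symm) c p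
      (by rw [add_comm]; exact h) (fun j => (hsplit j).symm)
    have c1 := waringRank_le (hasWaringDecomp_of_fintype hd0 _ _ e1)
    have c2 := waringRank_le (hasWaringDecomp_of_fintype hd0 _ _ e2)
    have hdj : Disjoint (Finset.univ.filter fun j => ¬ ∀ i, 1 ≤ A i → p j i = 0)
        (Finset.univ.filter fun j => ¬ ∀ i, 1 ≤ B i → p j i = 0) := by
      rw [Finset.disjoint_filter]
      intro j _ h1 h2
      exact (hsplit j).elim h1 h2
    have c3 := Finset.card_union_of_disjoint hdj
    have c4 := Finset.card_le_univ ((Finset.univ.filter fun j => ¬ ∀ i, 1 ≤ A i → p j i = 0) ∪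
      (Finset.univ.filter fun j => ¬ ∀ i, 1 ≤ B i → p j i = 0))
    rw [Fintype.card_fin] at c4
    have c1' := c1
    have c2' := c2
    rw [Fintype.card_subtype] at c1' c2'
    have hnz : ¬ ((∀ i, 1 ≤ A i → p j₀ i = 0) ∧ (∀ i, 1 ≤ B i → p j₀ i = 0)) := by
      rintro ⟨h1, h2⟩
      apply hL
      rw [← hj₀]
      ext i
      exact (hcov i).elim (h1 i) (h2 i)
    rcases hsplit j₀ with hj | hj
    · right
      refine ⟨hj₀ ▸ hj, ?_⟩
      have := inWaringLocus_of_fintype _ _ e2 (by rw [Fintype.card_subtype]; omega)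
        ⟨j₀, fun h2 => hnz ⟨hj, h2⟩⟩
      rwa [hj₀] at this
    · left
      refine ⟨hj₀ ▸ hj, ?_⟩
      have := inWaringLocus_of_fintype _ _ e1 (by rw [Fintype.card_subtype]; omega)
        ⟨j₀, fun h1 => hnz ⟨h1, hj⟩⟩
      rwa [hj₀] at this
  · rintro (⟨_, c, p, j₀, hj₀, h⟩ | ⟨_, c, p, j₀, hj₀, h⟩)
    · have h1 := hcomb c (fun _ => 1) p LB h (by simpa using hLB)
      have := inWaringLocus_of_fintype _ _ h1 (by simpa using hsumrank) (Sum.inl j₀)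
      rwa [Sum.elim_inl, hj₀] at this
    · have h1 := hcomb (fun _ => 1) c LA p (by simpa using hLA) h
      have := inWaringLocus_of_fintype _ _ h1 (by simpa using hsumrank) (Sum.inr j₀)
      rwa [Sum.elim_inr, hj₀] at this

/-- for `F = M₁ + M₂ = x₀x₁^{a₁}⋯xₙ^{aₙ} + y₀^{b₀}y₁^{b₁}⋯yₘ^{bₘ}` of
degree `d ≥ 3` (with `b₀` minimal among the `bᵢ`), the Waring locus of `F` is the
union of the Waring loci of `M₁` and `M₂`.  The variables are indexed by
`Fin (n+1) ⊕ Fin (m+1)`, `Sum.inl` for the `x`'s and `Sum.inr` for the `y`'s. -/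
theorem waring_locus_sum_of_two_coprime_monomials (n m : ℕ)
    (a : Fin (n + 1) → ℕ) (b : Fin (m + 1) → ℕ)
    (ha0 : a 0 = 1) (ha : ∀ i, 1 ≤ a i) (hb : ∀ j, 1 ≤ b j) (hbmin : ∀ j, b 0 ≤ b j)
    (d : ℕ) (hda : ∑ i, a i = d) (hdb : ∑ j, b j = d) (hd3 : 3 ≤ d) :
    ∀ L : (Fin (n + 1) ⊕ Fin (m + 1)) → ℂ, L ≠ 0 →
      (InWaringLocus d
          ((∏ i, X (Sum.inl i) ^ a i) + ∏ j, X (Sum.inr j) ^ b j :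
            MvPolynomial (Fin (n + 1) ⊕ Fin (m + 1)) ℂ) L ↔
        ((∀ k, L (Sum.inr k) = 0) ∧
          InWaringLocus d
            (∏ i, X (Sum.inl i) ^ a i : MvPolynomial (Fin (n + 1) ⊕ Fin (m + 1)) ℂ) L) ∨
        ((∀ k, L (Sum.inl k) = 0) ∧
          InWaringLocus d
            (∏ j, X (Sum.inr j) ^ b j : MvPolynomial (Fin (n + 1) ⊕ Fin (m + 1)) ℂ) L)) := by
  intro L hL
  have key := locus_abstract d (Finsupp.equivFunOnFinite.symm (Sum.elim a 0))
    (Finsupp.equivFunOnFinite.symm (Sum.elim 0 b)) (Sum.inl 0) (Sum.inr 0) hd3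
    (by rw [Finsupp.degree_eq_sum]; simp [hda]) (by rw [Finsupp.degree_eq_sum]; simp [hdb])
    (by simpa using ha0) (by simpa using hb 0)
    (by rintro (i | j) <;> simp [hbmin])
    (by rintro (i | j) <;> simp) (by rintro (i | j) <;> simp [ha, hb]) L hL
  have e1 : (monomial (Finsupp.equivFunOnFinite.symm (Sum.elim a 0)) 1 :
      MvPolynomial (Fin (n + 1) ⊕ Fin (m + 1)) ℂ) = ∏ i, X (Sum.inl i) ^ a i := by
    rw [monomial_eq, Finsupp.prod_fintype _ _ (by simp)]
    simp
  have e2 : (monomial (Finsupp.equivFunOnFinite.symm (Sum.elim 0 b)) 1 :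
      MvPolynomial (Fin (n + 1) ⊕ Fin (m + 1)) ℂ) = ∏ j, X (Sum.inr j) ^ b j := by
    rw [monomial_eq, Finsupp.prod_fintype _ _ (by simp)]
    simp
  rw [e1, e2] at key
  rw [key]
  have f1 : (∀ i, 1 ≤ (Finsupp.equivFunOnFinite.symm (Sum.elim 0 b) :
      Fin (n + 1) ⊕ Fin (m + 1) →₀ ℕ) i → L i = 0) ↔ ∀ k, L (Sum.inr k) = 0 := by
    constructor
    · intro h k
      exact h _ (by simpa using hb k)
    · rintro h (i | j) hi
      · simp at hi
      · exact h j
  have f2 : (∀ i, 1 ≤ (Finsupp.equivFunOnFinite.symm (Sum.elim a 0) :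
      Fin (n + 1) ⊕ Fin (m + 1) →₀ ℕ) i → L i = 0) ↔ ∀ k, L (Sum.inl k) = 0 := by
    constructor
    · intro h k
      exact h _ (by simpa using ha k)
    · rintro h (i | j) hi
      · exact h i
      · simp at hi
  rw [f1, f2]

end
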